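/- arXiv:2410.22634 — 3 statements merged into one kernel-verified Lean document; each statement's English description precedes it below -/
import Mathlib

section
/- Let 0 < η₁ < η₂ < η₃ < η₄, set Σ = [η₁,η₂] ∪ [η₃,η₄], and let r : Σ → ℝ be continuous with r(λ) > 0 for all λ ∈ Σ. If a continuous function f : Σ → ℂ satisfies f(λ) + (√(r(λ))/(2π)) ∫_Σ √(r(s)) f(s)/(s + λ) ds = 0 for every λ ∈ Σ, then f(λ) = 0 for every λ ∈ Σ. -/
open MeasureTheory Set in
/-- The Laplace representation of the Cauchy kernel. -/
theorem integral_Ioi_cexp_neg_mul {c : ℝ} (hc : 0 < c) :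
    ∫ x in Ioi (0 : ℝ), ((Real.exp (-c * x) : ℝ) : ℂ) = 1 / (c : ℂ) := by
  rw [integral_complex_ofReal, integral_exp_mul_Ioi (by linarith) 0]
  simp

open MeasureTheory Set ComplexConjugate in
/-- The kernel `1 / (s + l)` is positive semidefinite for measures supported in `[a, ∞)`,
`a > 0`. -/
theorem re_integral_conj_mul_integral_div_add_nonneg {μ : Measure ℝ} [SFinite μ] {a : ℝ}
    (ha : 0 < a) (hμ : ∀ᵐ s ∂μ, a ≤ s) {g : ℝ → ℂ} (hg : Integrable g μ) :
    0 ≤ (∫ l, conj (g l) * ∫ s, g s / ((s : ℂ) + (l : ℂ)) ∂μ ∂μ).re := by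
  set ν : Measure ℝ := volume.restrict (Ioi 0) with hν
  have hg' : Integrable (fun l => conj (g l)) μ :=
    hg.norm.mono' (Complex.continuous_conj.comp_aestronglyMeasurable hg.1)
      (.of_forall fun l => by simp)
  have hgg : Integrable (fun z : ℝ × ℝ => conj (g z.1) * g z.2) (μ.prod μ) := hg'.mul_prod hg
  have hsupp : ∀ᵐ z ∂μ.prod μ, a ≤ z.1 ∧ a ≤ z.2 :=
    (Measure.quasiMeasurePreserving_fst.ae hμ).and (Measure.quasiMeasurePreserving_snd.ae hμ)
  let F : ℝ × ℝ → ℝ → ℂ := fun z x =>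
    conj (g z.1) * g z.2 * ((Real.exp (-(z.2 + z.1) * x) : ℝ) : ℂ)
  have hF : Integrable (Function.uncurry F) ((μ.prod μ).prod ν) := by
    have hexp : Integrable (fun x : ℝ => Real.exp (-(2 * a) * x)) ν :=
      integrableOn_exp_mul_Ioi (by linarith) 0
    refine (hgg.norm.mul_prod hexp).mono' ?_ ?_
    · refine AEStronglyMeasurable.mul hgg.1.comp_fst ?_
      exact (by fun_prop : Continuous fun p : (ℝ × ℝ) × ℝ =>
        ((Real.exp (-(p.1.2 + p.1.1) * p.2) : ℝ) : ℂ)).aestronglyMeasurable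
    · have hx : ∀ᵐ x ∂ν, 0 < x := ae_restrict_mem measurableSet_Ioi
      filter_upwards [Measure.quasiMeasurePreserving_fst.ae hsupp,
        Measure.quasiMeasurePreserving_snd.ae hx] with p hp hx
      simp only [Function.uncurry, F, norm_mul, Complex.norm_real, Real.norm_eq_abs,
        Real.abs_exp]
      gcongr
      linarith
  have hinner : ∀ᵐ z ∂μ.prod μ,
      ∫ x, F z x ∂ν = conj (g z.1) * (g z.2 / ((z.2 : ℂ) + (z.1 : ℂ))) := by
    filter_upwards [hsupp] with z hz
    simp only [F]
    rw [integral_const_mul, integral_Ioi_cexp_neg_mul (by linarith)]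
    push_cast
    ring
  have hint : Integrable (fun z : ℝ × ℝ => conj (g z.1) * (g z.2 / ((z.2 : ℂ) + (z.1 : ℂ))))
      (μ.prod μ) := hF.integral_prod_left.congr hinner
  have hswap : ∫ l, conj (g l) * ∫ s, g s / ((s : ℂ) + (l : ℂ)) ∂μ ∂μ
      = ∫ x, ∫ z, F z x ∂μ.prod μ ∂ν := by
    rw [← integral_integral_swap hF, integral_congr_ae hinner, integral_prod _ hint]
    simp only [integral_const_mul]
  have hsq : ∀ x, ∫ z, F z x ∂μ.prod μ
      = ((Complex.normSq (∫ s, g s * ((Real.exp (-s * x) : ℝ) : ℂ) ∂μ) : ℝ) : ℂ) := by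
    intro x
    rw [Complex.normSq_eq_conj_mul_self, ← integral_conj, ← integral_prod_mul]
    congr 1 with z
    simp only [F, map_mul, Complex.conj_ofReal]
    rw [show -(z.2 + z.1) * x = -z.1 * x + -z.2 * x by ring, Real.exp_add]
    push_cast
    ring
  rw [hswap]
  simp only [hsq]
  rw [integral_complex_ofReal, Complex.ofReal_re]
  exact integral_nonneg fun x => Complex.normSq_nonneg _


/-- Triviality of the kernel of `I + T`, where `T` is the integral operator with kernel
`√(r(λ))√(r(s))/(2π(s+λ))` on `Σ = [η₁,η₂] ∪ [η₃,η₄]`: any continuous solution of the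
homogeneous equation vanishes identically on `Σ`. -/
theorem soliton_gas_operator_kernel_trivial (η₁ η₂ η₃ η₄ : ℝ)
    (h₀ : 0 < η₁) (h₁ : η₁ < η₂) (h₂ : η₂ < η₃) (h₃ : η₃ < η₄)
    (r : ℝ → ℝ) (hr : ContinuousOn r (Set.Icc η₁ η₂ ∪ Set.Icc η₃ η₄))
    (hrpos : ∀ l ∈ Set.Icc η₁ η₂ ∪ Set.Icc η₃ η₄, 0 < r l)
    (f : ℝ → ℂ) (hf : ContinuousOn f (Set.Icc η₁ η₂ ∪ Set.Icc η₃ η₄))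
    (heq : ∀ l ∈ Set.Icc η₁ η₂ ∪ Set.Icc η₃ η₄,
      f l + ((Real.sqrt (r l) / (2 * Real.pi) : ℝ) : ℂ)
          * ∫ s in Set.Icc η₁ η₂ ∪ Set.Icc η₃ η₄,
              ((Real.sqrt (r s) : ℝ) : ℂ) * f s / (((s : ℂ) + (l : ℂ))) = 0) :
    ∀ l ∈ Set.Icc η₁ η₂ ∪ Set.Icc η₃ η₄, f l = 0 := by
  set S : Set ℝ := Set.Icc η₁ η₂ ∪ Set.Icc η₃ η₄ with hS
  have hSc : IsCompact S := isCompact_Icc.union isCompact_Icc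
  have hSm : MeasurableSet S := hSc.measurableSet
  have hSpos : ∀ s ∈ S, η₁ ≤ s := by
    rintro s (hs | hs)
    · exact hs.1
    · linarith [hs.1]
  set g : ℝ → ℂ := fun s => ((Real.sqrt (r s) : ℝ) : ℂ) * f s with hg
  set T : ℝ → ℂ := fun l => ∫ s in S, g s / ((s : ℂ) + (l : ℂ)) with hT
  have hgc : ContinuousOn g S :=
    (Complex.continuous_ofReal.comp_continuousOn hr.sqrt).mul hf
  have hpos := re_integral_conj_mul_integral_div_add_nonneg h₀
    ((MeasureTheory.ae_restrict_mem hSm).mono hSpos)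
    (hgc.integrableOn_compact hSc (μ := MeasureTheory.volume))
  have hcongr : ∫ l in S, (starRingEnd ℂ) (g l) * T l
      = ∫ l in S, ((-(2 * Real.pi) * Complex.normSq (f l) : ℝ) : ℂ) := by
    refine MeasureTheory.setIntegral_congr_fun hSm fun l hl => ?_
    have hfl : ((Real.sqrt (r l) : ℝ) : ℂ) * T l = -(2 * Real.pi) * f l := by
      have h : f l + ((Real.sqrt (r l) / (2 * Real.pi) : ℝ) : ℂ) * T l = 0 := heq l hl
      have hpi : (Real.pi : ℂ) ≠ 0 := Complex.ofReal_ne_zero.mpr Real.pi_ne_zero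
      push_cast at h
      field_simp at h
      linear_combination h
    simp only [hg, map_mul, Complex.conj_ofReal]
    push_cast
    rw [Complex.normSq_eq_conj_mul_self]
    linear_combination (starRingEnd ℂ) (f l) * hfl
  change 0 ≤ (∫ l in S, (starRingEnd ℂ) (g l) * T l).re at hpos
  rw [hcongr, integral_complex_ofReal, Complex.ofReal_re, MeasureTheory.integral_const_mul] at hpos
  have hnn : 0 ≤ ∫ l in S, Complex.normSq (f l) :=
    MeasureTheory.integral_nonneg fun l => Complex.normSq_nonneg _
  have hzero : ∫ l in S, Complex.normSq (f l) = 0 := by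
    nlinarith [Real.pi_pos]
  have hae : (fun l => Complex.normSq (f l)) =ᵐ[MeasureTheory.volume.restrict S] 0 :=
    (MeasureTheory.integral_eq_zero_iff_of_nonneg (fun l => Complex.normSq_nonneg _)
      ((Complex.continuous_normSq.comp_continuousOn hf).integrableOn_compact hSc)).1 hzero
  intro l hl
  have hTl : T l = 0 := by
    refine MeasureTheory.integral_eq_zero_of_ae ?_
    filter_upwards [hae] with s hs
    simp [hg, Complex.normSq_eq_zero.1 hs]
  have h : f l + ((Real.sqrt (r l) / (2 * Real.pi) : ℝ) : ℂ) * T l = 0 := heq l hl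
  simpa [hTl] using h
end

section
/- Let τ be a symmetric 3×3 complex matrix (τᵢⱼ = τⱼᵢ) whose imaginary part Im τ is positive definite, and suppose τ₁₁ = τ₃₃ and τ₁₂ = τ₂₃. Then the 2×2 matrix τ̌ = [[τ₁₁ + τ₃₁, τ₁₂ + τ₃₂], [2τ₂₁, 2τ₂₂]] is symmetric and its imaginary part Im τ̌ is positive definite. -/
/-- If `τ` is a symmetric `3×3` complex matrix with positive definite imaginary part
satisfying `τ₁₁ = τ₃₃` and `τ₁₂ = τ₂₃`, then the reduced `2×2` matrix
`τ̌ = [[τ₁₁+τ₃₁, τ₁₂+τ₃₂],[2τ₂₁, 2τ₂₂]]` is symmetric with positive definite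
imaginary part. -/
theorem reduced_period_matrix_symm_posdef (τ : Matrix (Fin 3) (Fin 3) ℂ)
    (hsym : τ.IsSymm) (hpos : (τ.map Complex.im).PosDef)
    (h13 : τ 0 0 = τ 2 2) (h12 : τ 0 1 = τ 1 2) :
    (!![τ 0 0 + τ 2 0, τ 0 1 + τ 2 1; 2 * τ 1 0, 2 * τ 1 1] : Matrix (Fin 2) (Fin 2) ℂ).IsSymm ∧
    ((!![τ 0 0 + τ 2 0, τ 0 1 + τ 2 1; 2 * τ 1 0, 2 * τ 1 1] : Matrix (Fin 2) (Fin 2) ℂ).map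
        Complex.im).PosDef := by
  have h10 : τ 1 0 = τ 0 1 := hsym.apply 0 1
  have h20 : τ 2 0 = τ 0 2 := hsym.apply 0 2
  have h21 : τ 2 1 = τ 0 1 := (hsym.apply 1 2).trans h12.symm
  have hS : (!![τ 0 0 + τ 2 0, τ 0 1 + τ 2 1; 2 * τ 1 0, 2 * τ 1 1] :
      Matrix (Fin 2) (Fin 2) ℂ).IsSymm := by
    ext i j
    fin_cases i <;> fin_cases j <;> simp [h10, h21, two_mul]
  refine ⟨hS, Matrix.PosDef.of_dotProduct_mulVec_pos ?_ fun x hx => ?_⟩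
  · ext i j
    simpa using congrArg Complex.im (hS.apply i j)
  · have hv : ![x 0, 2 * x 1, x 0] ≠ 0 := by
      intro h
      apply hx
      ext i
      fin_cases i
      · simpa using congrFun h 0
      · simpa using congrFun h 1
    have h := hpos.dotProduct_mulVec_pos hv
    simp [dotProduct, Matrix.mulVec, Fin.sum_univ_succ, h10, h20, h21, ← h12, ← h13] at h ⊢
    linarith
end

section
/- The Whitham velocity function W(m) = 1 + 1/m² + (1/m² − 1)·K(m)/E(m) is strictly decreasing for m ∈ (0,1). Equivalently, for fixed η₁ > 0, the function α ↦ (α² + η₁²)/2 + (α² − η₁²)·K(η₁/α)/E(η₁/α) is strictly increasing on (η₁, ∞). -/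
open Real

/-- The complete elliptic integral of the first kind,
`K(m) = ∫₀^{π/2} dθ/√(1 − m² sin²θ)`. -/
noncomputable def ellipticK (m : ℝ) : ℝ :=
  ∫ θ in (0:ℝ)..(π / 2), 1 / Real.sqrt (1 - m ^ 2 * Real.sin θ ^ 2)

/-- The complete elliptic integral of the second kind,
`E(m) = ∫₀^{π/2} √(1 − m² sin²θ) dθ`. -/
noncomputable def ellipticE (m : ℝ) : ℝ :=
  ∫ θ in (0:ℝ)..(π / 2), Real.sqrt (1 - m ^ 2 * Real.sin θ ^ 2)

theorem one_sub_sq_mul_sin_sq_pos {m : ℝ} (hm : m ∈ Set.Ioo (0 : ℝ) 1) (θ : ℝ) :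
    0 < 1 - m ^ 2 * Real.sin θ ^ 2 := by
  nlinarith [hm.1, hm.2, Real.sin_sq_le_one θ, sq_nonneg m]

theorem continuous_ellipticE_integrand (m : ℝ) :
    Continuous fun θ : ℝ => Real.sqrt (1 - m ^ 2 * Real.sin θ ^ 2) := by
  fun_prop

theorem continuous_ellipticK_integrand {m : ℝ} (hm : m ∈ Set.Ioo (0 : ℝ) 1) :
    Continuous fun θ : ℝ => 1 / Real.sqrt (1 - m ^ 2 * Real.sin θ ^ 2) :=
  continuous_const.div (continuous_ellipticE_integrand m) fun θ =>
    (Real.sqrt_pos.2 (one_sub_sq_mul_sin_sq_pos hm θ)).ne'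

theorem ellipticE_pos {m : ℝ} (hm : m ∈ Set.Ioo (0 : ℝ) 1) : 0 < ellipticE m :=
  intervalIntegral.intervalIntegral_pos_of_pos
    ((continuous_ellipticE_integrand m).intervalIntegrable _ _)
    (fun θ => Real.sqrt_pos.2 (one_sub_sq_mul_sin_sq_pos hm θ)) Real.pi_div_two_pos

theorem ellipticK_pos {m : ℝ} (hm : m ∈ Set.Ioo (0 : ℝ) 1) : 0 < ellipticK m :=
  intervalIntegral.intervalIntegral_pos_of_pos
    ((continuous_ellipticK_integrand hm).intervalIntegrable _ _)
    (fun θ => one_div_pos.2 (Real.sqrt_pos.2 (one_sub_sq_mul_sin_sq_pos hm θ)))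
    Real.pi_div_two_pos

theorem sqrt_mul_sqrt_one_sub_sq_mul_sin_sq_le {a b : ℝ} (hb : b ∈ Set.Ioo (0 : ℝ) 1)
    (ha : 0 < a) (hab : a ≤ b) (θ : ℝ) :
    √(1 - b ^ 2) * √(1 - a ^ 2 * Real.sin θ ^ 2) ≤
      √(1 - a ^ 2) * √(1 - b ^ 2 * Real.sin θ ^ 2) := by
  have hb1 : 0 ≤ 1 - b ^ 2 := by nlinarith [hb.1, hb.2]
  have hab2 : a ^ 2 ≤ b ^ 2 := pow_le_pow_left₀ ha.le hab 2
  rw [← Real.sqrt_mul hb1, ← Real.sqrt_mul (by linarith)]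
  apply Real.sqrt_le_sqrt
  nlinarith [mul_nonneg (sub_nonneg.2 hab2) (sub_nonneg.2 (Real.sin_sq_le_one θ))]

/-- `E(m)/√(1 - m²)` is nondecreasing in `m`. -/
theorem sqrt_one_sub_sq_mul_ellipticE_le {a b : ℝ} (hb : b ∈ Set.Ioo (0 : ℝ) 1)
    (ha : 0 < a) (hab : a ≤ b) :
    √(1 - b ^ 2) * ellipticE a ≤ √(1 - a ^ 2) * ellipticE b := by
  unfold ellipticE
  rw [← intervalIntegral.integral_const_mul, ← intervalIntegral.integral_const_mul]
  exact intervalIntegral.integral_mono Real.pi_div_two_pos.le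
    (((continuous_ellipticE_integrand a).const_mul _).intervalIntegrable _ _)
    (((continuous_ellipticE_integrand b).const_mul _).intervalIntegrable _ _)
    (sqrt_mul_sqrt_one_sub_sq_mul_sin_sq_le hb ha hab)

/-- `√(1 - m²) K(m)` is nonincreasing in `m`. -/
theorem sqrt_one_sub_sq_mul_ellipticK_le {a b : ℝ} (hb : b ∈ Set.Ioo (0 : ℝ) 1)
    (ha : 0 < a) (hab : a ≤ b) :
    √(1 - b ^ 2) * ellipticK b ≤ √(1 - a ^ 2) * ellipticK a := by
  have ha' : a ∈ Set.Ioo (0 : ℝ) 1 := ⟨ha, hab.trans_lt hb.2⟩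
  unfold ellipticK
  rw [← intervalIntegral.integral_const_mul, ← intervalIntegral.integral_const_mul]
  refine intervalIntegral.integral_mono Real.pi_div_two_pos.le
    (((continuous_ellipticK_integrand hb).const_mul _).intervalIntegrable _ _)
    (((continuous_ellipticK_integrand ha').const_mul _).intervalIntegrable _ _) fun θ => ?_
  simp only [mul_one_div]
  rw [div_le_div_iff₀ (Real.sqrt_pos.2 (one_sub_sq_mul_sin_sq_pos hb θ))
    (Real.sqrt_pos.2 (one_sub_sq_mul_sin_sq_pos ha' θ))]
  exact sqrt_mul_sqrt_one_sub_sq_mul_sin_sq_le hb ha hab θ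

theorem antitoneOn_one_sub_sq_mul_ellipticK_div_ellipticE :
    AntitoneOn (fun m : ℝ => (1 - m ^ 2) * ellipticK m / ellipticE m) (Set.Ioo 0 1) := by
  intro a ha b hb hab
  have hb1 : 0 ≤ 1 - b ^ 2 := by nlinarith [hb.1, hb.2]
  have ha1 : 0 ≤ 1 - a ^ 2 := by nlinarith [ha.1, ha.2]
  have h := mul_le_mul (sqrt_one_sub_sq_mul_ellipticK_le hb ha.1 hab)
    (sqrt_one_sub_sq_mul_ellipticE_le hb ha.1 hab)
    (mul_nonneg (Real.sqrt_nonneg _) (ellipticE_pos ha).le)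
    (mul_nonneg (Real.sqrt_nonneg _) (ellipticK_pos ha).le)
  rw [mul_mul_mul_comm, mul_mul_mul_comm √(1 - a ^ 2), Real.mul_self_sqrt hb1,
    Real.mul_self_sqrt ha1, ← mul_assoc, ← mul_assoc] at h
  exact (div_le_div_iff₀ (ellipticE_pos hb) (ellipticE_pos ha)).2 h

theorem one_sub_sq_mul_ellipticK_div_ellipticE_pos {m : ℝ} (hm : m ∈ Set.Ioo (0 : ℝ) 1) :
    0 < (1 - m ^ 2) * ellipticK m / ellipticE m :=
  div_pos (mul_pos (by nlinarith [hm.1, hm.2]) (ellipticK_pos hm)) (ellipticE_pos hm)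

/-- The Whitham velocity `W(m) = 1 + 1/m² + (1/m² − 1) K(m)/E(m)` is strictly decreasing on
`(0,1)`; equivalently, for each fixed `η₁ > 0` the modulation relation
`α ↦ (α² + η₁²)/2 + (α² − η₁²) K(η₁/α)/E(η₁/α)` is strictly increasing on `(η₁, ∞)`. -/
theorem whitham_velocity_strictAnti :
    StrictAntiOn
      (fun m : ℝ => 1 + 1 / m ^ 2 + (1 / m ^ 2 - 1) * ellipticK m / ellipticE m)
      (Set.Ioo 0 1) ∧
    ∀ η₁ : ℝ, 0 < η₁ →
      StrictMonoOn
        (fun α : ℝ => (α ^ 2 + η₁ ^ 2) / 2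
          + (α ^ 2 - η₁ ^ 2) * ellipticK (η₁ / α) / ellipticE (η₁ / α))
        (Set.Ioi η₁) := by
  refine ⟨fun a ha b hb hab => ?_, fun η hη α hα β hβ hαβ => ?_⟩
  · have hF := antitoneOn_one_sub_sq_mul_ellipticK_div_ellipticE ha hb hab.le
    have hpos := one_sub_sq_mul_ellipticK_div_ellipticE_pos hb
    have hinv : 1 / b ^ 2 < 1 / a ^ 2 :=
      one_div_lt_one_div_of_lt (pow_pos ha.1 2) (pow_lt_pow_left₀ hab ha.1.le two_ne_zero)
    have hW : ∀ m : ℝ, 0 < m → (1 / m ^ 2 - 1) * ellipticK m / ellipticE m =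
        1 / m ^ 2 * ((1 - m ^ 2) * ellipticK m / ellipticE m) := fun m hm => by
      have : 1 / m ^ 2 - 1 = 1 / m ^ 2 * (1 - m ^ 2) := by field_simp
      rw [this]
      ring
    dsimp only at hF ⊢
    rw [hW a ha.1, hW b hb.1]
    have := mul_le_mul hinv.le hF hpos.le (one_div_nonneg.2 (sq_nonneg a))
    linarith
  · have hα0 : 0 < α := hη.trans hα
    have hβ0 : 0 < β := hη.trans hβ
    have hmα : η / α ∈ Set.Ioo (0 : ℝ) 1 := ⟨div_pos hη hα0, (div_lt_one hα0).2 hα⟩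
    have hmβ : η / β ∈ Set.Ioo (0 : ℝ) 1 := ⟨div_pos hη hβ0, (div_lt_one hβ0).2 hβ⟩
    have hF := antitoneOn_one_sub_sq_mul_ellipticK_div_ellipticE hmβ hmα
      (div_le_div_of_nonneg_left hη.le hα0 hαβ.le)
    have hpos := one_sub_sq_mul_ellipticK_div_ellipticE_pos hmα
    have hsq : α ^ 2 < β ^ 2 := pow_lt_pow_left₀ hαβ hα0.le two_ne_zero
    have hV : ∀ x : ℝ, 0 < x → (x ^ 2 - η ^ 2) * ellipticK (η / x) / ellipticE (η / x) =
        x ^ 2 * ((1 - (η / x) ^ 2) * ellipticK (η / x) / ellipticE (η / x)) := fun x hx => by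
      have : x ^ 2 - η ^ 2 = x ^ 2 * (1 - (η / x) ^ 2) := by field_simp
      rw [this]
      ring
    dsimp only at hF ⊢
    rw [hV α hα0, hV β hβ0]
    have := mul_le_mul hsq.le hF hpos.le (sq_nonneg β)
    linarith
end
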